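/- For every integer d ≥ 2 there is a constant C_d > 0 with the following property: every (d+1)-uniform hypergraph H on n vertices with more than C_d · n^{d + 1 − 1/2^{d−1}} edges contains, for some integer k ≥ 3, a copy of the (d−1)-fold suspension of a k-cycle, namely the (d+1)-uniform hypergraph whose vertex set consists of 2(d−1) + k distinct vertices a_1, b_1, …, a_{d−1}, b_{d−1}, w_0, w_1, …, w_{k−1} and whose edges are exactly the sets {x_1, …, x_{d−1}, w_j, w_{j+1 mod k}} for all choices x_i ∈ {a_i, b_i} (1 ≤ i ≤ d−1) and all 0 ≤ j ≤ k−1. -/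

import Mathlib

open Finset

/-- `H` contains the `r`-fold suspension of a cycle of length at least `3`. -/
def HasSuspendedCycle {V : Type*} [DecidableEq V] (r : ℕ) (H : Finset (Finset V)) : Prop :=
  ∃ (k : ℕ) (a b : Fin r → V) (w : Fin (k + 3) → V),
    Function.Injective (Sum.elim (Sum.elim a b) w : (Fin r ⊕ Fin r) ⊕ Fin (k + 3) → V) ∧
    ∀ (χ : Fin r → Bool) (j : Fin (k + 3)),
      (Finset.image (fun i => if χ i then a i else b i) Finset.univ ∪ {w j, w (j + 1)}) ∈ H

/-- The common link of `a` and `b` in `H`. -/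
def commonLink {V : Type*} [Fintype V] [DecidableEq V] (H : Finset (Finset V)) (a b : V) :
    Finset (Finset V) :=
  {S | a ∉ S ∧ b ∉ S ∧ insert a S ∈ H ∧ insert b S ∈ H}

theorem SimpleGraph.IsAcyclic.card_edgeFinset_lt {V : Type*} [Fintype V] [Nonempty V]
    {G : SimpleGraph V} [Fintype G.edgeSet] (hG : G.IsAcyclic) :
    #G.edgeFinset < Fintype.card V := by
  classical
  obtain ⟨T, hGT, -, hT⟩ :=
    (SimpleGraph.connected_top (V := V)).exists_isTree_le_of_le_of_isAcyclic le_top hG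
  have := hT.card_edgeFinset
  have := Finset.card_le_card (SimpleGraph.edgeFinset_mono hGT)
  omega

theorem hasSuspendedCycle_zero_of_card_le {V : Type*} [Fintype V] [Nonempty V] [DecidableEq V]
    {H : Finset (Finset V)} (hH : ∀ e ∈ H, #e = 2) (hcard : Fintype.card V ≤ #H) :
    HasSuspendedCycle 0 H := by
  classical
  let G : SimpleGraph V :=
    { Adj := fun u v => u ≠ v ∧ {u, v} ∈ H
      symm := ⟨fun u v h => ⟨h.1.symm, by rw [Finset.pair_comm]; exact h.2⟩⟩
      loopless := ⟨fun u h => h.1 rfl⟩ }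
  have hle : #H ≤ #G.edgeFinset := by
    refine Finset.card_le_card_of_surjOn Sym2.toFinset fun e he => ?_
    obtain ⟨u, v, huv, rfl⟩ := Finset.card_eq_two.1 (hH e he)
    refine ⟨s(u, v), ?_, by ext; simp⟩
    simpa [G, huv] using he
  have hG : ¬ G.IsAcyclic := fun h => by
    have := h.card_edgeFinset_lt
    omega
  rw [SimpleGraph.isAcyclic_iff_free_cycleGraph] at hG
  push Not at hG
  obtain ⟨m, hm, hfree⟩ := hG
  obtain ⟨k, rfl⟩ := Nat.exists_eq_add_of_le' hm
  obtain ⟨f⟩ := hfree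
  refine ⟨k, Fin.elim0, Fin.elim0, f, ?_, fun χ j => ?_⟩
  · rintro ((i | i) | i) ((j | j) | j) h
    all_goals first | exact i.elim0 | exact j.elim0 | skip
    exact congrArg _ (f.injective h)
  · have hadj : (SimpleGraph.cycleGraph (k + 3)).Adj j (j + 1) := by
      rw [SimpleGraph.cycleGraph_adj]
      right
      simp
    simpa using (f.toHom.map_adj hadj).2

theorem HasSuspendedCycle.of_commonLink {V : Type*} [Fintype V] [DecidableEq V] {r : ℕ}
    {H : Finset (Finset V)} {x y : V} (hxy : x ≠ y)
    (h : HasSuspendedCycle r (commonLink H x y)) : HasSuspendedCycle (r + 1) H := by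
  obtain ⟨k, a, b, w, hinj, hedge⟩ := h
  simp only [commonLink, Finset.mem_filter, Finset.mem_univ, true_and] at hedge
  have havoid : ∀ s, Sum.elim (Sum.elim a b) w s ≠ x ∧ Sum.elim (Sum.elim a b) w s ≠ y := by
    rintro ((i | i) | j)
    · have := hedge (fun _ => true) 0
      simp at this
      grind
    · have := hedge (fun _ => false) 0
      simp at this
      grind
    · have := hedge (fun _ => true) j
      simp at this
      grind
  refine ⟨k, Fin.cons x a, Fin.cons y b, w, ?_, fun χ j => ?_⟩
  · have ha i := havoid (.inl (.inl i))
    have hb i := havoid (.inl (.inr i))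
    have hw i := havoid (.inr i)
    simp only [Sum.elim_inl, Sum.elim_inr] at ha hb hw
    simp only [Function.Injective, Sum.forall, Fin.forall_fin_succ, Sum.elim_inl, Sum.elim_inr,
      Fin.cons_zero, Fin.cons_succ, Sum.inl.injEq, Sum.inr.injEq, Fin.succ_inj, reduceCtorEq]
      at hinj ⊢
    grind
  · obtain ⟨-, -, hx, hy⟩ := hedge (fun i => χ i.succ) j
    have himage : Finset.image (fun i => if χ i then (Fin.cons x a : Fin (r + 1) → V) i
          else (Fin.cons y b : Fin (r + 1) → V) i) Finset.univ =
        insert (if χ 0 then x else y)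
          (Finset.image (fun i : Fin r => if χ i.succ then a i else b i) Finset.univ) := by
      rw [Fin.univ_succ, Finset.cons_eq_insert, Finset.image_insert, Finset.map_eq_image,
        Finset.image_image]
      rfl
    rw [himage, Finset.insert_union]
    cases χ 0
    · simpa using hy
    · simpa using hx

/-- Cauchy–Schwarz on codegrees, counting pairs of edges that meet in a `q`-set. -/
theorem exists_sq_le_of_card_commonLink_le {V : Type*} [Fintype V] [DecidableEq V] {q : ℕ}
    {H : Finset (Finset V)} (hH : ∀ e ∈ H, #e = q + 1) {T : ℝ} (hT : 0 ≤ T)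
    (hlink : ∀ a b, a ≠ b → (#(commonLink H a b) : ℝ) ≤ T) :
    ∃ D : ℝ, (#H : ℝ) ≤ D ∧
      D ^ 2 ≤ (Fintype.card V : ℝ) ^ q * ((Fintype.card V : ℝ) ^ 2 * T + D) := by
  let ind (S : Finset V) (v : V) : ℝ := if v ∉ S ∧ insert v S ∈ H then 1 else 0
  let P : Finset (Finset V) := Finset.powersetCard q Finset.univ
  refine ⟨∑ S ∈ P, ∑ v, ind S v, ?_, ?_⟩
  · have hsum : ∑ S ∈ P, ∑ v, ind S v =
        (#{p ∈ P ×ˢ (Finset.univ : Finset V) | p.2 ∉ p.1 ∧ insert p.2 p.1 ∈ H} : ℝ) := by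
      rw [← Finset.sum_product', ← Finset.sum_boole]
    rw [hsum, Nat.cast_le]
    refine Finset.card_le_card_of_surjOn (fun p => insert p.2 p.1) fun e he => ?_
    have hcard := hH e he
    obtain ⟨v, hv⟩ := Finset.card_pos.1 (by omega : 0 < #e)
    refine ⟨(e.erase v, v), ?_, Finset.insert_erase hv⟩
    simpa [P, Finset.card_erase_of_mem hv, hcard, Finset.insert_erase hv] using he
  · have hpair (a b : V) : ∑ S ∈ P, ind S a * ind S b ≤
        T + if a = b then ∑ S ∈ P, ind S a else 0 := by
      by_cases hab : a = b
      · subst hab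
        simp only [if_true]
        have : ∑ S ∈ P, ind S a * ind S a = ∑ S ∈ P, ind S a :=
          Finset.sum_congr rfl fun S _ => by simp only [ind]; split_ifs <;> simp
        linarith
      · rw [if_neg hab, add_zero]
        refine le_trans ?_ (hlink a b hab)
        simp only [ind, ← ite_and, mul_ite, mul_one, mul_zero, Finset.sum_boole, Nat.cast_le]
        refine Finset.card_le_card fun S hS => ?_
        simp only [Finset.mem_filter] at hS
        simp only [commonLink, Finset.mem_filter, Finset.mem_univ, true_and]
        tauto
    have hP : (#P : ℝ) ≤ (Fintype.card V : ℝ) ^ q := by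
      have := Nat.choose_le_pow (Fintype.card V) q
      rw [Finset.card_powersetCard, Finset.card_univ]
      exact_mod_cast this
    have hsq : ∑ S ∈ P, (∑ v, ind S v) ^ 2 ≤
        (Fintype.card V : ℝ) ^ 2 * T + ∑ S ∈ P, ∑ v, ind S v := by
      calc ∑ S ∈ P, (∑ v, ind S v) ^ 2 = ∑ a, ∑ b, ∑ S ∈ P, ind S a * ind S b := by
            simp only [sq, Finset.sum_mul_sum]
            rw [Finset.sum_comm]
            exact Finset.sum_congr rfl fun a _ => Finset.sum_comm
        _ ≤ ∑ a, ∑ b, (T + if a = b then ∑ S ∈ P, ind S a else 0) :=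
            Finset.sum_le_sum fun a _ => Finset.sum_le_sum fun b _ => hpair a b
        _ = (Fintype.card V : ℝ) ^ 2 * T + ∑ S ∈ P, ∑ v, ind S v := by
            simp only [Finset.sum_add_distrib, Finset.sum_ite_eq, Finset.mem_univ, if_true,
              Finset.sum_const, Finset.card_univ, nsmul_eq_mul]
            rw [Finset.sum_comm]
            ring
    refine (sq_sum_le_card_mul_sum_sq).trans ?_
    exact mul_le_mul hP hsq (Finset.sum_nonneg fun _ _ => sq_nonneg _) (by positivity)

theorem card_eq_of_mem_commonLink {V : Type*} [Fintype V] [DecidableEq V] {q : ℕ}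
    {H : Finset (Finset V)} (hH : ∀ e ∈ H, #e = q + 1) {a b : V} :
    ∀ S ∈ commonLink H a b, #S = q := by
  intro S hS
  simp only [commonLink, Finset.mem_filter, Finset.mem_univ, true_and] at hS
  have := hH _ hS.2.2.1
  rw [Finset.card_insert_of_notMem hS.1] at this
  omega

theorem exists_const_forall_hasSuspendedCycle (r : ℕ) :
    ∃ C : ℝ, 0 < C ∧ ∀ (n : ℕ) (H : Finset (Finset (Fin n))), (∀ e ∈ H, #e = r + 2) →
      C * (n : ℝ) ^ ((r + 2 : ℝ) - 1 / 2 ^ r) < (#H : ℝ) → HasSuspendedCycle r H := by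
  have hpos : ∀ {r n : ℕ} {H : Finset (Finset (Fin n))} {x : ℝ}, (∀ e ∈ H, #e = r + 2) →
      0 ≤ x → x < (#H : ℝ) → 0 < n := by
    intro r n H x hH hx hlt
    obtain ⟨e, he⟩ := Finset.card_pos.1 (Nat.cast_pos.1 (hx.trans_lt hlt) : 0 < #H)
    have := card_finset_fin_le e
    have := hH e he
    omega
  induction r with
  | zero =>
    refine ⟨1, one_pos, fun n H hH hlt => ?_⟩
    have : NeZero n := ⟨(hpos hH (by positivity) hlt).ne'⟩
    refine hasSuspendedCycle_zero_of_card_le hH ?_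
    norm_num at hlt
    simpa using hlt.le
  | succ r ih =>
    obtain ⟨C, hC, ih⟩ := ih
    refine ⟨2 + 2 * C, by positivity, fun n H hH hlt => ?_⟩
    have hn : 0 < n := hpos hH (by positivity) hlt
    have hn' : (1 : ℝ) ≤ n := by exact_mod_cast hn
    have hn0 : (0 : ℝ) < n := by positivity
    by_contra hno
    obtain ⟨D, hHD, hD⟩ := exists_sq_le_of_card_commonLink_le (q := r + 2) hH
      (T := C * (n : ℝ) ^ ((r + 2 : ℝ) - 1 / 2 ^ r)) (by positivity) fun a b hab => by
        by_contra! hbig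
        exact hno ((ih n _ (card_eq_of_mem_commonLink hH) hbig).of_commonLink hab)
    rw [Fintype.card_fin] at hD
    set E : ℝ := (n : ℝ) ^ (((r + 1 : ℕ) + 2 : ℝ) - 1 / 2 ^ (r + 1)) with hE
    have hE0 : 0 < E := by positivity
    have hEn : (n : ℝ) ^ (r + 2) ≤ E := by
      rw [hE, ← Real.rpow_natCast]
      refine Real.rpow_le_rpow_of_exponent_le hn' ?_
      have : (1 : ℝ) / 2 ^ (r + 1) ≤ 1 :=
        (div_le_one (by positivity)).2 (one_le_pow₀ one_le_two)
      push_cast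
      linarith
    have hEsq : (n : ℝ) ^ (r + 2) * ((n : ℝ) ^ 2 * (n : ℝ) ^ ((r + 2 : ℝ) - 1 / 2 ^ r)) =
        E ^ 2 := by
      rw [hE, ← Real.rpow_mul_natCast hn0.le, ← Real.rpow_natCast _ (r + 2),
        ← Real.rpow_natCast (n : ℝ) 2, ← Real.rpow_add hn0, ← Real.rpow_add hn0]
      congr 1
      push_cast
      field_simp
      ring
    have hDE : (2 + 2 * C) * E < D := hlt.trans_le hHD
    have hD' : D ^ 2 ≤ C * E ^ 2 + E * D := by
      have : (n : ℝ) ^ (r + 2) * D ≤ E * D :=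
        mul_le_mul_of_nonneg_right hEn (le_trans (by positivity) hDE.le)
      rw [← hEsq]
      linarith
    nlinarith [mul_pos hC hE0, mul_pos hE0 hE0, mul_pos hC (mul_pos hE0 hE0),
      mul_pos (mul_pos hC hE0) (mul_pos hC hE0)]

/-- For every `d ≥ 2` there is `C > 0` such that every `(d+1)`-uniform
hypergraph `H` on `n` vertices with more than `C · n^(d + 1 - 1/2^(d-1))` edges contains,
for some `k ≥ 3` (here `k + 3` with `k : ℕ`), a copy of the `(d-1)`-fold suspension of a
`k`-cycle: there are `2(d-1) + k` distinct vertices `a i, b i (i < d-1)` and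
`w j (j < k)` such that `{x 1, …, x (d-1), w j, w (j+1 mod k)}` is an edge of `H` for
every choice `x i ∈ {a i, b i}` and every `j`. -/
theorem turan_upper_bound_suspension_of_cycle (d : ℕ) (hd : 2 ≤ d) :
    ∃ C : ℝ, 0 < C ∧
      ∀ (n : ℕ) (H : Finset (Finset (Fin n))),
        (∀ e ∈ H, e.card = d + 1) →
        C * (n : ℝ) ^ ((d + 1 : ℝ) - 1 / 2 ^ (d - 1)) < (H.card : ℝ) →
        ∃ (k : ℕ) (a b : Fin (d - 1) → Fin n) (w : Fin (k + 3) → Fin n),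
          Function.Injective
            (Sum.elim (Sum.elim a b) w : (Fin (d - 1) ⊕ Fin (d - 1)) ⊕ Fin (k + 3) → Fin n) ∧
          ∀ (χ : Fin (d - 1) → Bool) (j : Fin (k + 3)),
            (Finset.image (fun i => if χ i then a i else b i) Finset.univ
              ∪ {w j, w (j + 1)}) ∈ H := by
  obtain ⟨r, rfl⟩ := Nat.exists_eq_add_of_le' (show 1 ≤ d by omega)
  obtain ⟨C, hC, h⟩ := exists_const_forall_hasSuspendedCycle r
  refine ⟨C, hC, fun n H hH hlt => h n H hH ?_⟩
  convert hlt using 4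
  · push_cast
    ring
  · rw [Nat.add_sub_cancel]
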